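/- arXiv:1510.00657 — 2 statements merged into one kernel-verified Lean document; each statement's English description precedes it below -/
import Mathlib

section
/- For the plactic-type ideal I_B, the noncommutative column-flagged Schur function J_α(n) indexed by a composition α = (α_1,...,α_l) with α_{j+1} = α_j + 1 and flags n with n_{j+1} = n_j for some j is congruent to 0 modulo I_B. -/
open FreeAlgebra

/-- Noncommutative elementary symmetric function `e_k(u_S)`. -/
noncomputable def ncElem (N : ℕ) (k : ℤ) (S : Finset (Fin N)) : FreeAlgebra ℤ (Fin N) :=
  if k < 0 then 0 else
  ∑ T ∈ S.powersetCard k.toNat, (((T.sort (· ≤ ·)).reverse).map (ι ℤ)).prod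

/-- The set `[m] = {1,…,m}` of generators, as a subset of `Fin N` (0-indexed). -/
def initSeg (N m : ℕ) : Finset (Fin N) := Finset.univ.filter (fun i => (i : ℕ) < m)

/-- The noncommutative column-flagged Schur function
`J_α(n) = ∑_{π ∈ S_l} sgn(π) e_{α_1+π(1)-1}(u_{[n_1]}) ⋯ e_{α_l+π(l)-l}(u_{[n_l]})`
(indices written `0`-based: the `j`-th factor is `e_{α_j + π(j) - j}(u_{[n_j]})`). -/
noncomputable def Jcf (N l : ℕ) (α : Fin l → ℕ) (n : Fin l → ℕ) : FreeAlgebra ℤ (Fin N) :=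
  ∑ π : Equiv.Perm (Fin l),
    ((Equiv.Perm.sign π : ℤˣ) : ℤ) •
      ((List.finRange l).map (fun j =>
        ncElem N ((α j : ℤ) + ((π j : ℕ) : ℤ) - ((j : ℕ) : ℤ)) (initSeg N (n j)))).prod

/-- Generators of the ideal `I_B`. -/
def genB (N : ℕ) : Set (FreeAlgebra ℤ (Fin N)) :=
  {x | ∃ a b : Fin N, a < b ∧
      x = ι ℤ b * ι ℤ b * ι ℤ a + ι ℤ a * ι ℤ b * ι ℤ a
        - ι ℤ b * ι ℤ a * ι ℤ b - ι ℤ b * ι ℤ a * ι ℤ a} ∪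
  {x | ∃ a b c : Fin N, a < b ∧ b < c ∧
      x = ι ℤ b * ι ℤ c * ι ℤ a - ι ℤ b * ι ℤ a * ι ℤ c} ∪
  {x | ∃ a b c : Fin N, a < b ∧ b < c ∧
      x = ι ℤ a * ι ℤ c * ι ℤ b - ι ℤ c * ι ℤ a * ι ℤ b}


namespace Stmt14Aux

section ring
variable {W : Type*} [Ring W]

/-- The generating product. -/
def E {ι' : Type*} (u : ι' → W) (x : W) (L : List ι') : W := (L.map (fun i => 1 + x * u i)).prod

lemma absorb_right {ι' : Type*} (u : ι' → W) (x K : W) (hx : ∀ w, x * w = w * x) (L : List ι')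
    (h : ∀ i ∈ L, K * u i = 0) : K * E u x L = K := by
  induction L with
  | nil => simp [E]
  | cons b L ih =>
    have h1 : K * (1 + x * u b) = K := by
      rw [mul_add, ← mul_assoc, ← hx, mul_assoc, h b (by simp)]; simp
    have h2 : E u x (b :: L) = (1 + x * u b) * E u x L := by simp [E]
    rw [h2, ← mul_assoc, h1]
    exact ih (fun i hi => h i (by simp [hi]))

lemma absorb_left {ι' : Type*} (u : ι' → W) (x K : W) (hx : ∀ w, x * w = w * x) (L : List ι')
    (h : ∀ i ∈ L, u i * K = 0) : E u x L * K = K := by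
  induction L with
  | nil => simp [E]
  | cons b L ih =>
    have h1 : (1 + x * u b) * K = K := by
      rw [add_mul, mul_assoc, h b (by simp)]; simp
    have h2 : E u x (b :: L) = (1 + x * u b) * E u x L := by simp [E]
    rw [h2, mul_assoc, ih (fun i hi => h i (by simp [hi])), h1]

lemma E_unit {ι' : Type*} (u : ι' → W) (x : W) (L : List ι')
    (h : ∀ w, IsUnit (1 + x * w)) : IsUnit (E u x L) := by
  induction L with
  | nil => simp [E]
  | cons b L ih =>
    have h2 : E u x (b :: L) = (1 + x * u b) * E u x L := by simp [E]
    rw [h2]; exact (h _).mul ih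

lemma step (x y a c P Q : W) (hx : ∀ w, x * w = w * x) (hy : ∀ w, y * w = w * y)
    (hP : IsUnit P) (hQ : IsUnit Q) (hPQ : P * Q = Q * P)
    (hc : ((1 + x * c) * P) * ((1 + y * c) * Q) = ((1 + y * c) * Q) * ((1 + x * c) * P))
    (ha : (P * (1 + x * a)) * (Q * (1 + y * a)) = (Q * (1 + y * a)) * (P * (1 + x * a)))
    (K : W) (hK : K = a * c - c * a) (hKP : K * P = K) (hPK : P * K = K) (hKQ : K * Q = K)
    (hQK : Q * K = K) (hcK : c * K = K * a) :
    ((1 + x * c) * P * (1 + x * a)) * ((1 + y * c) * Q * (1 + y * a)) =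
    ((1 + y * c) * Q * (1 + y * a)) * ((1 + x * c) * P * (1 + x * a)) := by
  have m1 : ∀ x y : W, (∀ w, x * w = w * x) → (∀ w, y * w = w * y) →
      (1 + x * a) * (1 + y * c) = (1 + y * c) * (1 + x * a) + x * y * K := by
    intro x y hx hy
    have e1 : x * a * (y * c) = x * y * (a * c) := by
      rw [mul_assoc x a, ← mul_assoc a y, ← hy a]; simp only [mul_assoc]
    have e2 : y * c * (x * a) = x * y * (c * a) := by
      rw [mul_assoc y c, ← mul_assoc c x, ← hx c, hx y]; simp only [mul_assoc]
    rw [hK, mul_sub, ← e1, ← e2]; noncomm_ring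
  obtain ⟨P', rfl⟩ := hP
  obtain ⟨Q', rfl⟩ := hQ
  set P : W := (P' : W) with hPdef
  set Q : W := (Q' : W) with hQdef
  set p : W := ((P'⁻¹ : Wˣ) : W)
  set q : W := ((Q'⁻¹ : Wˣ) : W)
  have pP : p * P = 1 := by simp [p, P]
  have Pp : P * p = 1 := by simp [p, P]
  have qQ : q * Q = 1 := by simp [q, Q]
  have Qq : Q * q = 1 := by simp [q, Q]
  have hA : (1 + x * c) * P * (1 + y * c) = (1 + y * c) * Q * (1 + x * c) * (P * q) := by
    calc (1 + x * c) * P * (1 + y * c) = ((1 + x * c) * P) * ((1 + y * c) * Q) * q := by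
          simp only [mul_assoc, Qq, mul_one]
      _ = _ := by rw [hc]; simp only [mul_assoc]
  have hB : (1 + x * a) * Q * (1 + y * a) = (p * Q) * ((1 + y * a) * P * (1 + x * a)) := by
    calc (1 + x * a) * Q * (1 + y * a) = p * ((P * (1 + x * a)) * (Q * (1 + y * a))) := by
          simp only [← mul_assoc, pP, one_mul]
      _ = _ := by rw [ha]; simp only [mul_assoc]
  have hmid : (P * q) * (p * Q) = 1 := by
    have : q * p = p * q := by
      have h := congrArg (fun u : Wˣ => ((u⁻¹ : Wˣ) : W))
        (show P' * Q' = Q' * P' from Units.ext hPQ)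
      simpa [mul_inv_rev] using h
    calc (P * q) * (p * Q) = P * (q * p) * Q := by simp only [mul_assoc]
      _ = (P * p) * (q * Q) := by rw [this]; simp only [mul_assoc]
      _ = 1 := by rw [Pp, qQ, one_mul]
  have hxyc : ∀ w, x * y * w = w * (x * y) := fun w => by
    rw [mul_assoc, hy, ← mul_assoc, hx, mul_assoc]
  have hPKQ : P * (x * y * K) * Q = x * y * K := by
    rw [← mul_assoc, ← hxyc, mul_assoc, mul_assoc, mul_assoc, hKQ, hPK, mul_assoc]
  have hQKP : Q * (x * y * K) * P = x * y * K := by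
    rw [← mul_assoc, ← hxyc, mul_assoc, mul_assoc, mul_assoc, hKP, hQK, mul_assoc]
  have dist : ∀ A B C D F G : W, A * B * (C + D) * F * G = A * B * C * F * G + A * B * D * F * G := by
    intro A B C D F G; rw [mul_add, add_mul, add_mul]
  have L1 : ((1 + x * c) * P * (1 + x * a)) * ((1 + y * c) * Q * (1 + y * a)) =
      (1 + y * c) * Q * ((1 + x * c) * (1 + y * a)) * P * (1 + x * a)
        + (1 + x * c) * (x * y * K) * (1 + y * a) := by
    calc _ = (1 + x * c) * P * ((1 + x * a) * (1 + y * c)) * Q * (1 + y * a) := by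
          simp only [mul_assoc]
      _ = ((1 + x * c) * P * (1 + y * c)) * ((1 + x * a) * Q * (1 + y * a))
          + (1 + x * c) * (P * (x * y * K) * Q) * (1 + y * a) := by
          rw [m1 x y hx hy, dist]; simp only [mul_assoc]
      _ = (1 + y * c) * Q * (1 + x * c) * ((P * q) * (p * Q)) * ((1 + y * a) * P * (1 + x * a))
          + (1 + x * c) * (x * y * K) * (1 + y * a) := by
          rw [hPKQ, hA, hB]; simp only [mul_assoc]
      _ = _ := by rw [hmid]; simp only [mul_assoc, one_mul]
  have R1 : ((1 + y * c) * Q * (1 + y * a)) * ((1 + x * c) * P * (1 + x * a)) =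
      (1 + y * c) * Q * ((1 + x * c) * (1 + y * a)) * P * (1 + x * a)
        + (1 + y * c) * (x * y * K) * (1 + x * a) := by
    calc _ = (1 + y * c) * Q * ((1 + y * a) * (1 + x * c)) * P * (1 + x * a) := by
          simp only [mul_assoc]
      _ = (1 + y * c) * Q * ((1 + x * c) * (1 + y * a)) * P * (1 + x * a)
          + (1 + y * c) * (Q * (x * y * K) * P) * (1 + x * a) := by
          rw [m1 y x hy hx, ← hx y, dist]; simp only [mul_assoc]
      _ = _ := by rw [hQKP]
  rw [L1, R1]
  congr 1
  have hz : c * (x * y * K) = (x * y * K) * a := by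
    rw [← mul_assoc, ← hxyc, mul_assoc, hcK, mul_assoc (x * y)]
  generalize x * y * K = Z at hz
  have e : ∀ x y : W, (∀ w, y * w = w * y) → (1 + x * c) * Z * (1 + y * a) =
      Z + x * (Z * a) + y * (Z * a) + x * y * (Z * a * a) := by
    intro x y hy
    have e1 : Z * (y * a) = y * (Z * a) := by rw [← mul_assoc, ← hy, mul_assoc]
    have e2 : x * c * Z = x * (Z * a) := by rw [mul_assoc, hz]
    have e3 : x * (Z * a) * (y * a) = x * y * (Z * a * a) := by
      rw [mul_assoc x, ← mul_assoc (Z * a), ← hy]; simp only [mul_assoc]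
    rw [add_mul, mul_add, one_mul, mul_one, e2, add_mul, e1, e3]
    abel
  rw [e x y hy, e y x hx, hx y]
  abel

lemma E_comm {N : ℕ} (u : Fin N → W) (x y : W) (hx : ∀ w, x * w = w * x)
    (hy : ∀ w, y * w = w * y)
    (hxu : ∀ w, IsUnit (1 + x * w)) (hyu : ∀ w, IsUnit (1 + y * w))
    (r1 : ∀ a b, a < b → u b * u b * u a + u a * u b * u a - u b * u a * u b - u b * u a * u a = 0)
    (r2 : ∀ a b c, a < b → b < c → u b * u c * u a - u b * u a * u c = 0)
    (r3 : ∀ a b c, a < b → b < c → u a * u c * u b - u c * u a * u b = 0) :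
    ∀ (k : ℕ) (L : List (Fin N)), L.length = k → L.Pairwise (· > ·) →
      E u x L * E u y L = E u y L * E u x L := by
  intro k
  induction k using Nat.strong_induction_on with
  | _ k ih =>
  intro L hL hs
  rcases L with _ | ⟨c, L⟩
  · simp [E]
  rcases List.eq_nil_or_concat L with rfl | ⟨M, a, rfl⟩
  · have : ∀ x y : W, (∀ w, y * w = w * y) → (1 + x * u c) * (1 + y * u c) =
      1 + x * u c + y * u c + x * y * (u c * u c) := by
      intro x y hy
      have : x * u c * (y * u c) = x * y * (u c * u c) := by
        rw [mul_assoc, ← mul_assoc (u c), ← hy]; simp only [mul_assoc]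
      rw [← this]; noncomm_ring
    simp only [E, List.map_cons, List.map_nil, List.prod_cons, List.prod_nil, mul_one]
    rw [this x y hy, this y x hx, hx y]; abel
  · rw [List.concat_eq_append] at *
    simp only [List.length_cons, List.length_append, List.length_nil] at hL
    have hac : a < c := (List.pairwise_cons.1 hs).1 a (by simp)
    have hcM : ∀ b ∈ M, b < c := fun b hb => (List.pairwise_cons.1 hs).1 b (by simp [hb])
    have hsMa := (List.pairwise_cons.1 hs).2
    have haM : ∀ b ∈ M, a < b := fun b hb => (List.pairwise_append.1 hsMa).2.2 b hb a (by simp)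
    have hsM := (List.pairwise_append.1 hsMa).1
    have hscM : (c :: M).Pairwise (· > ·) := List.pairwise_cons.2 ⟨hcM, hsM⟩
    have iM := ih M.length (by omega) M rfl hsM
    have icM := ih (M.length + 1) (by omega) (c :: M) rfl hscM
    have iMa := ih (M.length + 1) (by omega) (M ++ [a]) (by simp) hsMa
    have hcons : ∀ z, E u z (c :: M) = (1 + z * u c) * E u z M := fun z => by simp [E]
    have happ : ∀ z, E u z (M ++ [a]) = E u z M * (1 + z * u a) := fun z => by simp [E]
    have hall : ∀ z, E u z (c :: (M ++ [a])) = (1 + z * u c) * E u z M * (1 + z * u a) :=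
      fun z => by simp [E, mul_assoc]
    rw [hcons, hcons] at icM
    rw [happ, happ] at iMa
    rw [hall, hall]
    have k1 : ∀ b ∈ M, (u a * u c - u c * u a) * u b = 0 := fun b hb => by
      rw [sub_mul]; exact r3 a b c (haM b hb) (hcM b hb)
    have k2 : ∀ b ∈ M, u b * (u a * u c - u c * u a) = 0 := fun b hb => by
      have := r2 a b c (haM b hb) (hcM b hb)
      rw [mul_sub, ← mul_assoc, ← mul_assoc, ← neg_sub, this, neg_zero]
    refine step x y (u a) (u c) _ _ hx hy (E_unit u x M hxu) (E_unit u y M hyu) iM icM iMa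
      (u a * u c - u c * u a) rfl (absorb_right u x _ hx M k1) (absorb_left u x _ hx M k2)
      (absorb_right u y _ hy M k1) (absorb_left u y _ hy M k2) ?_
    have := r1 a c hac
    rw [← sub_eq_zero, ← neg_eq_zero, ← this]; noncomm_ring

end ring

/-- The decreasing word of a finite set. -/
def decr {N : ℕ} (S : Finset (Fin N)) : List (Fin N) := (S.sort (· ≤ ·)).reverse

lemma decr_pairwise {N : ℕ} (S : Finset (Fin N)) : (decr S).Pairwise (· > ·) := by
  unfold decr
  rw [List.pairwise_reverse]
  exact (Finset.sortedLT_sort S).pairwise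

lemma decr_insert {N : ℕ} (S : Finset (Fin N)) (c : Fin N) (h : ∀ b ∈ S, b < c) :
    decr (insert c S) = c :: decr S := by
  have hc : c ∉ S := fun hc => lt_irrefl _ (h c hc)
  refine List.Perm.eq_of_pairwise (le := (· > ·)) ?_ (decr_pairwise _) ?_ ?_
  · intro a b _ _ h1 h2; exact absurd h1 (lt_asymm h2)
  · refine List.pairwise_cons.2 ⟨fun b hb => h b (by simpa [decr] using hb), decr_pairwise _⟩
  · refine (List.perm_ext_iff_of_nodup ?_ ?_).2 ?_
    · simp [decr]
    · simp [decr, hc]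
    · intro a; simp [decr]

lemma E_expand {N : ℕ} {W : Type*} [Ring W] (u : Fin N → W) (x : W) (hx : ∀ w, x * w = w * x)
    (S : Finset (Fin N)) :
    E u x (decr S) = ∑ T ∈ S.powerset, x ^ T.card * ((decr T).map u).prod := by
  induction S using Finset.induction_on_max with
  | empty => simp [E, decr]
  | insert c S h ih =>
    have hc : c ∉ S := fun hc => lt_irrefl _ (h c hc)
    rw [decr_insert S c h, Finset.sum_powerset_insert hc, ← ih]
    have h2 : E u x (c :: decr S) = (1 + x * u c) * E u x (decr S) := by simp [E]
    rw [h2, add_mul, one_mul]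
    congr 1
    rw [ih, Finset.mul_sum]
    refine Finset.sum_congr rfl fun T hT => ?_
    have hTS := Finset.mem_powerset.1 hT
    rw [decr_insert T c (fun b hb => h b (hTS hb)),
      Finset.card_insert_of_notMem (fun hh => hc (hTS hh)), List.map_cons, List.prod_cons, pow_succ']
    have : u c * x ^ T.card = x ^ T.card * u c := by
      have : Commute x (u c) := hx _
      exact (this.pow_left _).symm.eq
    rw [mul_assoc x, ← mul_assoc (u c), this]
    simp only [mul_assoc]

open PowerSeries in
lemma elem_comm {N : ℕ} {R : Type*} [Ring R] (u : Fin N → R)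
    (r1 : ∀ a b, a < b → u b * u b * u a + u a * u b * u a - u b * u a * u b - u b * u a * u a = 0)
    (r2 : ∀ a b c, a < b → b < c → u b * u c * u a - u b * u a * u c = 0)
    (r3 : ∀ a b c, a < b → b < c → u a * u c * u b - u c * u a * u b = 0)
    (S : Finset (Fin N)) (k l : ℕ) :
    (∑ T ∈ S.powersetCard k, ((decr T).map u).prod) *
      (∑ T ∈ S.powersetCard l, ((decr T).map u).prod) =
    (∑ T ∈ S.powersetCard l, ((decr T).map u).prod) *
      (∑ T ∈ S.powersetCard k, ((decr T).map u).prod) := by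
  let φ : R →+* R⟦X⟧⟦X⟧ := (C (R := R⟦X⟧)).comp (C (R := R))
  let x : R⟦X⟧⟦X⟧ := C X
  let y : R⟦X⟧⟦X⟧ := X
  have hx : ∀ w, x * w = w * x := by
    intro w
    ext1 n
    simp only [x, coeff_C_mul, coeff_mul_C]
    exact (commute_X _).symm.eq
  have hy : ∀ w, y * w = w * y := fun w => (commute_X w).symm.eq
  have hxu : ∀ w, IsUnit (1 + x * w) := by
    intro w
    rw [isUnit_iff_constantCoeff, isUnit_iff_constantCoeff]
    simp [x]
  have hyu : ∀ w, IsUnit (1 + y * w) := by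
    intro w
    rw [isUnit_iff_constantCoeff]
    simp [y]
  have main := E_comm (fun i => φ (u i)) x y hx hy hxu hyu
    (fun a b h => by simpa using congrArg φ (r1 a b h))
    (fun a b c h h' => by simpa using congrArg φ (r2 a b c h h'))
    (fun a b c h h' => by simpa using congrArg φ (r3 a b c h h')) _ (decr S) rfl (decr_pairwise S)
  have hw : ∀ T : Finset (Fin N), ((decr T).map (fun i => φ (u i))).prod
      = C (C (((decr T).map u).prod)) := by
    intro T
    have : C (C (((decr T).map u).prod)) = φ (((decr T).map u).prod) := rfl
    rw [this, map_list_prod, List.map_map]; rfl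
  rw [E_expand _ x hx, E_expand _ y hy] at main
  simp only [hw] at main
  set p : R⟦X⟧ := ∑ T ∈ S.powerset, X ^ T.card * C (((decr T).map u).prod) with hp
  have hxp : ∑ T ∈ S.powerset, x ^ T.card * C (C (((decr T).map u).prod)) = C p := by
    simp [hp, x, map_sum]
  have hcoef : ∀ (R' : Type _) [Ring R'] (g : Finset (Fin N) → R') (l : ℕ),
      coeff l (∑ T ∈ S.powerset, (X : R'⟦X⟧) ^ T.card * C (g T)) =
        ∑ T ∈ S.powersetCard l, g T := by
    intro R' _ g l
    rw [map_sum, Finset.powersetCard_eq_filter, Finset.sum_filter]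
    refine Finset.sum_congr rfl fun T _ => ?_
    rw [coeff_mul_C, coeff_X_pow]
    by_cases h : T.card = l
    · simp [h]
    · simp [h, Ne.symm h]
  rw [hxp] at main
  have m1 := congrArg (coeff l) main
  rw [coeff_C_mul, coeff_mul_C, hcoef, ← map_sum] at m1
  have m2 := congrArg (coeff k) m1
  rw [coeff_C_mul, coeff_mul_C, hcoef] at m2
  exact m2

lemma prod_swap {R : Type*} [Ring R] (l j : ℕ) (j0 j1 : Fin l) (hj0 : j0.val = j) (hj1 : j1.val = j + 1) (F G : Fin l → R)
    (h1 : F j0 = G j1) (h2 : F j1 = G j0)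
    (h3 : ∀ i, i ≠ j0 → i ≠ j1 → F i = G i)
    (hc : G j0 * G j1 = G j1 * G j0) :
    ((List.finRange l).map F).prod = ((List.finRange l).map G).prod := by
  have hl := j1.isLt
  have hsplit : List.finRange l = (List.finRange l).take j ++
      (j0 :: j1 :: (List.finRange l).drop (j + 2)) := by
    conv_lhs => rw [← List.take_append_drop j (List.finRange l)]
    rw [List.drop_eq_getElem_cons (by simp; omega), List.drop_eq_getElem_cons (by simp; omega)]
    simp [Fin.ext_iff, hj0, hj1]
  have hnd := List.nodup_finRange l
  generalize (List.finRange l).take j = A at hsplit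
  generalize (List.finRange l).drop (j + 2) = B at hsplit
  rw [hsplit] at hnd ⊢
  rw [List.nodup_append] at hnd
  obtain ⟨_, hB, hAB⟩ := hnd
  rw [List.nodup_cons, List.nodup_cons] at hB
  have eA : A.map F = A.map G := List.map_congr_left fun i hi =>
    h3 i (hAB i hi _ (by simp)) (hAB i hi _ (by simp))
  have eB : B.map F = B.map G := List.map_congr_left fun i hi =>
    h3 i (by rintro rfl; exact hB.1 (by simp [hi])) (by rintro rfl; exact hB.2.1 hi)
  simp only [List.map_append, List.map_cons, List.prod_append, List.prod_cons, eA, eB, h1, h2]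
  rw [← mul_assoc (G _) (G _), ← hc, mul_assoc (G _) (G _)]

end Stmt14Aux

open Stmt14Aux in
/-- If `α_{j+1} = α_j + 1` and `n_{j+1} = n_j` for some `j`, then `J_α(n) ≡ 0 (mod I_B)`. -/
theorem stmt14 (N l : ℕ) (α n : Fin l → ℕ) (hn : ∀ i, n i ≤ N)
    (j : ℕ) (hj : j + 1 < l)
    (hα : α ⟨j + 1, hj⟩ = α ⟨j, by omega⟩ + 1)
    (hne : n ⟨j + 1, hj⟩ = n ⟨j, by omega⟩) :
    Jcf N l α n ∈ TwoSidedIdeal.span (genB N) := by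
  set I := TwoSidedIdeal.span (genB N) with hI
  let f : FreeAlgebra ℤ (Fin N) →+* I.ringCon.Quotient := I.ringCon.mk'
  have hf : ∀ x, x ∈ I ↔ f x = 0 := by
    intro x
    rw [← TwoSidedIdeal.mem_ker, TwoSidedIdeal.ker_ringCon_mk']
  have hgen : ∀ x ∈ genB N, f x = 0 := fun x hx => (hf x).1 (TwoSidedIdeal.subset_span hx)
  have hcomm : ∀ (k k' : ℤ) (S : Finset (Fin N)),
      f (ncElem N k S) * f (ncElem N k' S) = f (ncElem N k' S) * f (ncElem N k S) := by
    intro k k' S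
    have key := elem_comm (fun i => f (ι ℤ i))
      (fun a b h => by
        simpa using hgen _ (Or.inl (Or.inl ⟨a, b, h, rfl⟩)))
      (fun a b c h h' => by
        simpa using hgen _ (Or.inl (Or.inr ⟨a, b, c, h, h', rfl⟩)))
      (fun a b c h h' => by
        simpa using hgen _ (Or.inr ⟨a, b, c, h, h', rfl⟩)) S k.toNat k'.toNat
    have hE : ∀ k : ℤ, 0 ≤ k → f (ncElem N k S) =
        ∑ T ∈ S.powersetCard k.toNat, ((decr T).map (fun i => f (ι ℤ i))).prod := by
      intro k hk
      rw [ncElem, if_neg (by omega), map_sum]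
      refine Finset.sum_congr rfl fun T _ => ?_
      rw [map_list_prod, List.map_map]; rfl
    by_cases hk : k < 0
    · simp [ncElem, hk]
    by_cases hk' : k' < 0
    · simp [ncElem, hk']
    rw [hE k (by omega), hE k' (by omega)]
    exact key
  rw [hf, Jcf, map_sum]
  have hne' : (⟨j, by omega⟩ : Fin l) ≠ ⟨j + 1, hj⟩ := by simp
  refine Finset.sum_involution
    (fun π _ => π * Equiv.swap (⟨j, by omega⟩ : Fin l) ⟨j + 1, hj⟩) ?_ ?_ ?_ ?_
  · intro π _
    rw [map_zsmul, map_zsmul, Equiv.Perm.sign_mul, Equiv.Perm.sign_swap hne', map_list_prod,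
      map_list_prod, List.map_map, List.map_map]
    rw [prod_swap l j ⟨j, by omega⟩ ⟨j + 1, hj⟩ rfl rfl _ (f ∘ fun i => ncElem N ((α i : ℤ) +
      (((π * Equiv.swap (⟨j, by omega⟩ : Fin l) ⟨j + 1, hj⟩) i : ℕ) : ℤ) - ((i : ℕ) : ℤ))
        (initSeg N (n i)))]
    · simp
    · simp only [Function.comp, Equiv.Perm.mul_apply, Equiv.swap_apply_right, hα, hne]
      congr 2; push_cast; ring
    · simp only [Function.comp, Equiv.Perm.mul_apply, Equiv.swap_apply_left, hα, hne]
      congr 2; push_cast; ring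
    · intro i hi hi'
      simp only [Function.comp, Equiv.Perm.mul_apply, Equiv.swap_apply_of_ne_of_ne hi hi']
    · simp only [Function.comp, hne]
      exact hcomm _ _ _
  · intro π _ _ h
    have := congrArg Equiv.Perm.sign h
    rw [Equiv.Perm.sign_mul, Equiv.Perm.sign_swap hne'] at this
    simp at this
  · intro π _; exact Finset.mem_univ _
  · intro π _; simp [mul_assoc]
end

section
/- The symmetric function of the 20-vertex switchboard on the words {432165, 432615, 426315, 264315, 264153, 261543, 216543, 426351, 624153, 425631, 462351, 624513, 641253, 452631, 462513, 641523, 456231, 456213, 465123, 645123}, defined as the sum of the fundamental quasisymmetric functions Q_{Des(w)} over these words, equals s_{321} + s_{2211} - s_{222}; in particular it is not Schur positive. -/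
/-- Fundamental quasisymmetric function of the descent set of `w`. -/
noncomputable def Qdes (w : List ℕ) : MvPowerSeries ℕ ℤ := fun m =>
  (((Finset.univ : Finset (Fin w.length → {a : ℕ // a ∈ m.support})).filter
    (fun i =>
      (∀ j k : Fin w.length, (j : ℕ) + 1 = (k : ℕ) →
        ((i j : ℕ) ≤ (i k : ℕ) ∧ (w.getD (k : ℕ) 0 < w.getD (j : ℕ) 0 → (i j : ℕ) < (i k : ℕ)))) ∧
      (∀ a ∈ m.support, (Finset.univ.filter (fun j : Fin w.length => (i j : ℕ) = a)).card = m a))).card : ℤ)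

/-- Schur function of a Young diagram. -/
noncomputable def schurF (μ : YoungDiagram) : MvPowerSeries ℕ ℤ := fun m =>
  (((Finset.univ : Finset (μ.cells → {a : ℕ // a ∈ m.support})).filter
    (fun f =>
      (∀ c1 c2 : μ.cells, (c1 : ℕ × ℕ).1 = (c2 : ℕ × ℕ).1 → (c1 : ℕ × ℕ).2 + 1 = (c2 : ℕ × ℕ).2 → (f c1 : ℕ) ≤ (f c2 : ℕ)) ∧
      (∀ c1 c2 : μ.cells, (c1 : ℕ × ℕ).2 = (c2 : ℕ × ℕ).2 → (c1 : ℕ × ℕ).1 + 1 = (c2 : ℕ × ℕ).1 → (f c1 : ℕ) < (f c2 : ℕ)) ∧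
      (∀ a ∈ m.support, (Finset.univ.filter (fun c : μ.cells => (f c : ℕ) = a)).card = m a))).card : ℤ)

/-- Coefficient of the fundamental quasisymmetric function with descent indicator `D`. -/
noncomputable def QD (m : ℕ →₀ ℕ) (D : Fin 6 → Fin 6 → Bool) : ℤ :=
  (((Finset.univ : Finset (Fin 6 → {a : ℕ // a ∈ m.support})).filter
    (fun i =>
      (∀ j k : Fin 6, (j : ℕ) + 1 = (k : ℕ) →
        ((i j : ℕ) ≤ (i k : ℕ) ∧ (D j k = true → (i j : ℕ) < (i k : ℕ)))) ∧
      (∀ a ∈ m.support, (Finset.univ.filter (fun j : Fin 6 => (i j : ℕ) = a)).card = m a))).card : ℤ)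

/-- The descents of a sequence, as a list of booleans. -/
def desList (w : Fin 6 → ℕ) : List Bool :=
  [decide (w 1 < w 0), decide (w 2 < w 1), decide (w 3 < w 2), decide (w 4 < w 3),
    decide (w 5 < w 4)]

/-- The coefficient attached to a list of booleans. -/
noncomputable def QL (m : ℕ →₀ ℕ) (l : List Bool) : ℤ := QD m (fun j _ => l.getD (j : ℕ) false)

lemma QD_eq_QL (m : ℕ →₀ ℕ) (w : Fin 6 → ℕ) :
    QD m (fun j k => decide (w k < w j)) = QL m (desList w) := by
  unfold QL QD
  congr 2
  apply Finset.filter_congr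
  intro i _
  refine and_congr_left fun _ => ?_
  refine forall_congr' fun j => forall_congr' fun k => imp_congr_right fun h => ?_
  have : decide (w k < w j) = (desList w).getD (j : ℕ) false := by
    fin_cases j <;> fin_cases k <;> simp at h <;> rfl
  simp only [this]

lemma Qdes_eq (m : ℕ →₀ ℕ) (a b c d e f : ℕ) :
    Qdes [a, b, c, d, e, f] m = QL m (desList ![a, b, c, d, e, f]) := by
  rw [← QD_eq_QL]
  unfold Qdes QD
  have h : ∀ j : Fin 6, [a, b, c, d, e, f].getD (j : ℕ) 0 = ![a, b, c, d, e, f] j := by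
    intro j; fin_cases j <;> rfl
  simp only [← h, decide_eq_true_eq]
  rfl

/-- Adjacency of two cells. -/
def adj (p q : ℕ × ℕ) : Prop := (p.1 = q.1 ∧ p.2 + 1 = q.2) ∨ (p.2 = q.2 ∧ p.1 + 1 = q.1)

instance (p q : ℕ × ℕ) : Decidable (adj p q) := by unfold adj; infer_instance

/-- Linear extensions, i.e. standard fillings. -/
def LinExt (pos : Fin 6 → ℕ × ℕ) (σ : Equiv.Perm (Fin 6)) : Prop :=
  ∀ i j : Fin 6, adj (pos (σ i)) (pos (σ j)) → i < j

instance (pos : Fin 6 → ℕ × ℕ) (σ : Equiv.Perm (Fin 6)) : Decidable (LinExt pos σ) := by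
  unfold LinExt; infer_instance

lemma sort_lt_iff {α : Type*} [LinearOrder α] (f : Fin 6 → α) (σ : Equiv.Perm (Fin 6)) :
    Tuple.sort f = σ ↔ StrictMono (fun j => toLex (f (σ j), σ j)) := by
  rw [eq_comm, Tuple.eq_sort_iff]
  constructor
  · rintro ⟨h1, h2⟩ i j hij
    rw [Prod.Lex.toLex_lt_toLex]
    rcases (h1 hij.le).lt_or_eq with h | h
    · exact Or.inl h
    · exact Or.inr ⟨h, h2 i j hij h⟩
  · intro h
    refine ⟨fun i j hij => ?_, fun i j hij he => ?_⟩
    · rcases hij.lt_or_eq with hlt | rfl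
      · have := h hlt
        rw [Prod.Lex.toLex_lt_toLex] at this
        rcases this with h' | h'
        · exact h'.le
        · exact h'.1.le
      · exact le_rfl
    · have := h hij
      rw [Prod.Lex.toLex_lt_toLex] at this
      rcases this with h' | h'
      · exact absurd he h'.ne
      · exact h'.2

lemma sort_iff {s : Finset ℕ} (f : Fin 6 → {a : ℕ // a ∈ s}) (σ : Equiv.Perm (Fin 6)) :
    Tuple.sort f = σ ↔ ∀ j k : Fin 6, (j : ℕ) + 1 = (k : ℕ) →
        ((f (σ j) : ℕ) ≤ (f (σ k) : ℕ) ∧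
          (decide (((σ k : Fin 6) : ℕ) < ((σ j : Fin 6) : ℕ)) = true →
            (f (σ j) : ℕ) < (f (σ k) : ℕ))) := by
  rw [sort_lt_iff, Fin.strictMono_iff_lt_succ (n := 5)]
  constructor
  · intro h j k hjk
    have h1 := h ⟨j, by omega⟩
    have e1 : (Fin.castSucc ⟨j, by omega⟩ : Fin 6) = j := rfl
    have e2 : (Fin.succ ⟨j, by omega⟩ : Fin 6) = k := Fin.ext hjk
    rw [e1, e2, Prod.Lex.toLex_lt_toLex] at h1
    rw [decide_eq_true_eq]
    rcases h1 with h' | ⟨h', h''⟩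
    · exact ⟨le_of_lt h', fun _ => h'⟩
    · refine ⟨le_of_eq (congrArg _ h'), fun hh => absurd h'' (not_lt_of_gt hh)⟩
  · intro h i
    have := h i.castSucc i.succ (by simp)
    rw [Prod.Lex.toLex_lt_toLex]
    rw [decide_eq_true_eq] at this
    by_cases hh : f (σ i.castSucc) < f (σ i.succ)
    · exact Or.inl hh
    · refine Or.inr ⟨le_antisymm this.1 (not_lt.mp hh), ?_⟩
      rcases lt_trichotomy (σ i.castSucc) (σ i.succ) with h3 | h3 | h3
      · exact h3
      · have := σ.injective h3
        exact absurd this (Fin.castSucc_lt_succ (i := i)).ne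
      · exact absurd (this.2 h3) hh

lemma valid_iff {α : Type*} [LinearOrder α] (pos : Fin 6 → ℕ × ℕ)
    (hrow : ∀ a b, (pos a).1 = (pos b).1 → (pos a).2 + 1 = (pos b).2 → a < b)
    (hcol : ∀ a b, (pos a).2 = (pos b).2 → (pos a).1 + 1 = (pos b).1 → b < a)
    (f : Fin 6 → α) (σ : Equiv.Perm (Fin 6)) (hσ : Tuple.sort f = σ) :
    ((∀ a b, (pos a).1 = (pos b).1 → (pos a).2 + 1 = (pos b).2 → f a ≤ f b) ∧
     (∀ a b, (pos a).2 = (pos b).2 → (pos a).1 + 1 = (pos b).1 → f a < f b)) ↔ LinExt pos σ := by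
  rw [sort_lt_iff] at hσ
  have key : ∀ i j, i < j ↔ (f (σ i) < f (σ j) ∨ f (σ i) = f (σ j) ∧ σ i < σ j) := by
    intro i j
    rw [← hσ.lt_iff_lt, Prod.Lex.toLex_lt_toLex]
  constructor
  · rintro ⟨h1, h2⟩ i j (⟨ha, hb⟩ | ⟨ha, hb⟩)
    · rw [key]
      rcases (h1 _ _ ha hb).lt_or_eq with h | h
      · exact Or.inl h
      · exact Or.inr ⟨h, hrow _ _ ha hb⟩
    · rw [key]
      exact Or.inl (h2 _ _ ha hb)
  · intro h
    constructor
    · intro a b ha hb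
      have := h (σ.symm a) (σ.symm b) (by simpa [adj] using Or.inl ⟨ha, hb⟩)
      rw [key] at this
      simp only [Equiv.apply_symm_apply] at this
      rcases this with h | h
      · exact h.le
      · exact h.1.le
    · intro a b ha hb
      have := h (σ.symm a) (σ.symm b) (by simpa [adj] using Or.inr ⟨ha, hb⟩)
      rw [key] at this
      simp only [Equiv.apply_symm_apply] at this
      rcases this with h | h
      · exact h
      · exact absurd h.2 (not_lt_of_gt (hcol _ _ ha hb))

lemma schurF_eq (μ : YoungDiagram) (pos : Fin 6 → ℕ × ℕ) (hinj : Function.Injective pos)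
    (hcells : Finset.univ.image pos = μ.cells)
    (hrow : ∀ a b, (pos a).1 = (pos b).1 → (pos a).2 + 1 = (pos b).2 → a < b)
    (hcol : ∀ a b, (pos a).2 = (pos b).2 → (pos a).1 + 1 = (pos b).1 → b < a)
    (m : ℕ →₀ ℕ) :
    schurF μ m = (((((Finset.univ : Finset (Equiv.Perm (Fin 6))).filter (LinExt pos)).val.map
      (fun σ => desList (fun j => (σ j : ℕ)))).map (QL m)).sum) := by
  have hmem : ∀ a, pos a ∈ μ.cells := fun a => by
    rw [← hcells]; exact Finset.mem_image_of_mem _ (Finset.mem_univ _)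
  let e : Fin 6 ≃ μ.cells := Equiv.ofBijective (fun a => ⟨pos a, hmem a⟩) (by
    refine ⟨fun a b h => hinj (congrArg Subtype.val h), fun c => ?_⟩
    have : (c : ℕ × ℕ) ∈ Finset.univ.image pos := (Finset.ext_iff.1 hcells _).2 c.2
    obtain ⟨a, _, ha⟩ := Finset.mem_image.mp this
    exact ⟨a, Subtype.ext ha⟩)
  have he : ∀ a, ((e a : μ.cells) : ℕ × ℕ) = pos a := fun a => rfl
  -- transport to `Fin 6`
  have step1 : schurF μ m = (((Finset.univ : Finset (Fin 6 → {a : ℕ // a ∈ m.support})).filter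
      (fun f => ((∀ a b, (pos a).1 = (pos b).1 → (pos a).2 + 1 = (pos b).2 → f a ≤ f b) ∧
        (∀ a b, (pos a).2 = (pos b).2 → (pos a).1 + 1 = (pos b).1 → f a < f b)) ∧
        (∀ a ∈ m.support,
          (Finset.univ.filter (fun j : Fin 6 => (f j : ℕ) = a)).card = m a))).card : ℤ) := by
    unfold schurF
    congr 1
    refine Finset.card_equiv (e.symm.arrowCongr (Equiv.refl _)) ?_
    intro f
    simp only [Finset.mem_filter, Finset.mem_univ, true_and, and_assoc]
    refine and_congr ?_ (and_congr ?_ ?_)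
    · constructor
      · intro h a b
        exact h (e a) (e b)
      · intro h c1 c2
        obtain ⟨a, rfl⟩ := e.surjective c1
        obtain ⟨b, rfl⟩ := e.surjective c2
        exact h a b
    · constructor
      · intro h a b
        exact h (e a) (e b)
      · intro h c1 c2
        obtain ⟨a, rfl⟩ := e.surjective c1
        obtain ⟨b, rfl⟩ := e.surjective c2
        exact h a b
    · refine forall_congr' fun a => imp_congr_right fun _ => ?_
      have : (Finset.univ.filter (fun c : μ.cells => (f c : ℕ) = a)).card =
          (Finset.univ.filter (fun j : Fin 6 => (f (e j) : ℕ) = a)).card := by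
        symm
        refine Finset.card_equiv e ?_
        intro i
        simp
      rw [this]
      rfl
  rw [step1, Finset.card_eq_sum_card_fiberwise (f := Tuple.sort)
    (t := (Finset.univ : Finset (Equiv.Perm (Fin 6)))) (by intro x _; simp)]
  rw [Multiset.map_map]
  change _ = ∑ σ ∈ (Finset.univ : Finset (Equiv.Perm (Fin 6))).filter (LinExt pos),
    QL m (desList (fun j => (σ j : ℕ)))
  rw [Finset.sum_filter]
  push_cast
  refine Finset.sum_congr rfl fun σ _ => ?_
  split_ifs with hσ
  · rw [← QD_eq_QL]
    unfold QD
    congr 1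
    refine Finset.card_equiv (σ.symm.arrowCongr (Equiv.refl _)) ?_
    intro f
    simp only [Finset.mem_filter, Finset.mem_univ, true_and]
    have hc : (∀ a ∈ m.support, (Finset.univ.filter (fun j : Fin 6 => (f j : ℕ) = a)).card = m a) ↔
      (∀ a ∈ m.support, (Finset.univ.filter (fun j : Fin 6 => (f (σ j) : ℕ) = a)).card = m a) := by
      refine forall_congr' fun a => imp_congr_right fun _ => ?_
      have : (Finset.univ.filter (fun j : Fin 6 => (f (σ j) : ℕ) = a)).card =
          (Finset.univ.filter (fun j : Fin 6 => (f j : ℕ) = a)).card := by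
        refine Finset.card_equiv σ ?_
        intro i
        simp
      rw [this]
    constructor
    · rintro ⟨⟨hv, hm⟩, hs⟩
      exact ⟨(sort_iff f σ).1 hs, hc.1 hm⟩
    · rintro ⟨hv, hm⟩
      have hs := (sort_iff f σ).2 hv
      exact ⟨⟨(valid_iff pos hrow hcol f σ hs).2 hσ, hc.2 hm⟩, hs⟩
  · rw [Nat.cast_eq_zero, Finset.card_eq_zero, Finset.filter_eq_empty_iff]
    intro f hf hs
    exact hσ ((valid_iff pos hrow hcol f σ hs).1 (Finset.mem_filter.1 hf).2.1)

/-- Descent lists of the linear extensions. -/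
def desM (pos : Fin 6 → ℕ × ℕ) : Multiset (List Bool) :=
  ((Finset.univ : Finset (Equiv.Perm (Fin 6))).filter (LinExt pos)).val.map
      (fun σ => desList (fun j => (σ j : ℕ)))

/-- Cells of (3,2,1) in reading order. -/
def pos321 : Fin 6 → ℕ × ℕ := ![(2,0), (1,0), (1,1), (0,0), (0,1), (0,2)]
/-- Cells of (2,2,1,1) in reading order. -/
def pos2211 : Fin 6 → ℕ × ℕ := ![(3,0), (2,0), (1,0), (1,1), (0,0), (0,1)]
/-- Cells of (2,2,2) in reading order. -/
def pos222 : Fin 6 → ℕ × ℕ := ![(2,0), (2,1), (1,0), (1,1), (0,0), (0,1)]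

/-- Descents of the twenty words. -/
def wordsM : List (List Bool) :=
  [desList ![4,3,2,1,6,5], desList ![4,3,2,6,1,5], desList ![4,2,6,3,1,5],
   desList ![2,6,4,3,1,5], desList ![2,6,4,1,5,3],
   desList ![2,6,1,5,4,3], desList ![2,1,6,5,4,3], desList ![4,2,6,3,5,1],
   desList ![6,2,4,1,5,3], desList ![4,2,5,6,3,1],
   desList ![4,6,2,3,5,1], desList ![6,2,4,5,1,3], desList ![6,4,1,2,5,3],
   desList ![4,5,2,6,3,1], desList ![4,6,2,5,1,3],
   desList ![6,4,1,5,2,3], desList ![4,5,6,2,3,1], desList ![4,5,6,2,1,3],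
   desList ![4,6,5,1,2,3], desList ![6,4,5,1,2,3]]

set_option maxRecDepth 100000 in
lemma main_count : (wordsM : Multiset (List Bool)) + desM pos222 = desM pos321 + desM pos2211 := by
  decide +kernel

/-- The switchboard symmetric function of the 20-vertex switchboard of
Figure 5 of Blasiak–Fomin (words in the alphabet `{1,…,6}`) equals
`s_{321} + s_{2211} - s_{222}`; in particular it is not Schur positive. -/
theorem stmt17 :
    ([[4,3,2,1,6,5], [4,3,2,6,1,5], [4,2,6,3,1,5], [2,6,4,3,1,5], [2,6,4,1,5,3],
      [2,6,1,5,4,3], [2,1,6,5,4,3], [4,2,6,3,5,1], [6,2,4,1,5,3], [4,2,5,6,3,1],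
      [4,6,2,3,5,1], [6,2,4,5,1,3], [6,4,1,2,5,3], [4,5,2,6,3,1], [4,6,2,5,1,3],
      [6,4,1,5,2,3], [4,5,6,2,3,1], [4,5,6,2,1,3], [4,6,5,1,2,3], [6,4,5,1,2,3]].map
        Qdes).sum
      = schurF (YoungDiagram.ofRowLens [3,2,1] (by decide))
        + schurF (YoungDiagram.ofRowLens [2,2,1,1] (by decide))
        - schurF (YoungDiagram.ofRowLens [2,2,2] (by decide)) := by
  ext m
  have h1 := schurF_eq (YoungDiagram.ofRowLens [3,2,1] (by decide)) pos321 (by decide +kernel)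
    (by decide +kernel) (by decide +kernel) (by decide +kernel) m
  have h2 := schurF_eq (YoungDiagram.ofRowLens [2,2,1,1] (by decide)) pos2211 (by decide +kernel)
    (by decide +kernel) (by decide +kernel) (by decide +kernel) m
  have h3 := schurF_eq (YoungDiagram.ofRowLens [2,2,2] (by decide)) pos222 (by decide +kernel)
    (by decide +kernel) (by decide +kernel) (by decide +kernel) m
  have h4 := congrArg (fun s => (Multiset.map (QL m) s).sum) main_count
  simp only [Multiset.map_add, Multiset.sum_add, Multiset.map_coe, Multiset.sum_coe] at h4
  rw [map_sub, map_add]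
  change _ = schurF _ m + schurF _ m - schurF _ m
  rw [h1, h2, h3]
  change _ = ((desM pos321).map (QL m)).sum + ((desM pos2211).map (QL m)).sum
    - ((desM pos222).map (QL m)).sum
  rw [← h4, add_sub_cancel_right, map_list_sum, List.map_map]
  have hc : ∀ w, (⇑(MvPowerSeries.coeff (R := ℤ) m) ∘ Qdes) w = Qdes w m := fun _ => rfl
  simp only [wordsM, List.map_cons, List.map_nil, hc, Qdes_eq]
end
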